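/- Let p be a prime and suppose A, B ⊆ 𝔽_p satisfy A + B = R_p with |A|, |B| ≥ 2. If there exists η ∈ [0, 1/2) with 𝔄(A,B) ≤ η(p−1), then |A| ≥ √p / (2·4^η) and |B| ≥ √p / (2·4^η). -/

import Mathlib

open scoped Pointwise

def Rp (p : ℕ) [NeZero p] : Finset (ZMod p) :=
  Finset.univ.filter fun x => x ≠ 0 ∧ IsSquare x

def repCount {p : ℕ} (A B : Finset (ZMod p)) (x : ZMod p) : ℕ :=
  ((A ×ˢ B).filter fun ab => ab.1 + ab.2 = x).card

def uniqueRep {p : ℕ} (A B : Finset (ZMod p)) : ℕ :=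
  ((A + B).filter fun x => repCount A B x = 1).card

def addEnergy' {p : ℕ} (A B : Finset (ZMod p)) : ℕ :=
  (((A ×ˢ A) ×ˢ B ×ˢ B).filter fun t => t.1.1 + t.2.1 = t.1.2 + t.2.2).card


open Polynomial in
lemma lag_weights {F : Type*} [Field F] [DecidableEq F] (A : Finset F) (hA : 1 ≤ A.card) :
    ∃ c : F → F, (∀ b : F, ∀ k < A.card - 1, ∑ a ∈ A, c a * (a + b) ^ k = 0) ∧
      ∀ b : F, ∑ a ∈ A, c a * (a + b) ^ (A.card - 1) = 1 := by
  refine ⟨fun a => (∏ j ∈ A.erase a, (a - j))⁻¹, ?_⟩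
  have key : ∀ b : F, ∀ k ≤ A.card - 1,
      ∑ a ∈ A, (∏ j ∈ A.erase a, (a - j))⁻¹ * (a + b) ^ k
        = ((X + C b) ^ k : F[X]).coeff (A.card - 1) := by
    intro b k hk
    have hdeg : ((X + C b) ^ k : F[X]).degree < A.card := by
      rw [degree_pow, degree_X_add_C]
      simp only [nsmul_eq_mul, mul_one]
      exact_mod_cast (by omega : k < A.card)
    rw [Lagrange.coeff_eq_sum (s := A) (v := fun x => x) (fun x _ y _ h => h) hdeg]
    refine Finset.sum_congr rfl fun a _ => ?_
    simp [div_eq_mul_inv, mul_comm]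
  refine ⟨fun b k hk => ?_, fun b => ?_⟩
  · rw [key b k hk.le, coeff_X_add_C_pow, Nat.choose_eq_zero_of_lt hk]; simp
  · rw [key b _ le_rfl, coeff_X_add_C_pow]; simp

open Polynomial in
lemma stepanov (p : ℕ) [hp : Fact p.Prime] (A B : Finset (ZMod p)) (m : ℕ) (hm : 1 ≤ m)
    (hmp : 2 * m < p)
    (hA : 1 ≤ A.card) (hB : 1 ≤ B.card)
    (h : ∀ a ∈ A, ∀ b ∈ B, (a + b) ^ m = 1) : A.card * B.card ≤ m := by
  have hAm : A.card ≤ m := by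
    obtain ⟨b, hb⟩ := Finset.card_pos.mp hB
    have h1 : A.image (fun a => a + b) ⊆ (nthRoots m (1 : ZMod p)).toFinset := by
      intro x hx
      obtain ⟨a, ha, rfl⟩ := Finset.mem_image.mp hx
      rw [Multiset.mem_toFinset, mem_nthRoots (by omega)]
      exact h a ha b hb
    calc A.card = (A.image (fun a => a + b)).card :=
          (Finset.card_image_of_injective _ (add_left_injective b)).symm
      _ ≤ _ := Finset.card_le_card h1
      _ ≤ _ := Multiset.toFinset_card_le _
      _ ≤ m := card_nthRoots _ _
  obtain ⟨c, hc0, hc1⟩ := lag_weights A hA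
  set n := A.card with hn
  set D := n - 1 + m with hD
  set F : (ZMod p)[X] := ∑ a ∈ A, C (c a) * (X + C a) ^ D - 1 with hF
  have hco : ∀ k, 1 ≤ k → F.coeff k = (∑ a ∈ A, c a * a ^ (D - k)) * (D.choose k : ZMod p) := by
    intro k hk
    rw [hF, coeff_sub, finsetSum_coeff, Finset.sum_mul, coeff_one, if_neg (by omega), sub_zero]
    refine Finset.sum_congr rfl fun a _ => ?_
    rw [coeff_C_mul, coeff_X_add_C_pow, mul_assoc]
  have hdeg : F.natDegree ≤ m := by
    rw [natDegree_le_iff_coeff_eq_zero]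
    intro k hk
    rw [hco k (by omega)]
    by_cases hkD : D < k
    · rw [Nat.choose_eq_zero_of_lt hkD]; simp
    · have := hc0 0 (D - k) (by omega)
      simp only [add_zero] at this
      rw [this, zero_mul]
  have hF0 : F ≠ 0 := by
    intro h0
    have h1 := hco m hm
    have h2 := hc1 0
    simp only [add_zero] at h2
    rw [h0, coeff_zero, show D - m = n - 1 by omega, h2, one_mul] at h1
    have h3 : p ∣ D.choose m := (ZMod.natCast_eq_zero_iff _ _).mp h1.symm
    have h4 : p ∣ D.factorial := by
      rw [← Nat.choose_mul_factorial_mul_factorial (show m ≤ D by omega), mul_assoc]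
      exact h3.mul_right _
    have := (hp.out.dvd_factorial).mp h4
    omega
  have hdvd : ∀ b ∈ B, (X - C b) ^ n ∣ F := by
    intro b hb
    rw [X_sub_C_pow_dvd_iff, X_pow_dvd_iff]
    intro k hk
    have hcomp : F.comp (X + C b) = ∑ a ∈ A, C (c a) * (X + C (a + b)) ^ D - 1 := by
      rw [hF, sub_comp, one_comp, Polynomial.sum_comp]
      congr 1
      refine Finset.sum_congr rfl fun a _ => ?_
      simp only [mul_comp, C_comp, pow_comp, add_comp, X_comp, C_add]
      ring
    have hs : ∑ a ∈ A, c a * (a + b) ^ (D - k) = ∑ a ∈ A, c a * (a + b) ^ (n - 1 - k) := by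
      refine Finset.sum_congr rfl fun a ha => ?_
      rw [show D - k = (n - 1 - k) + m by omega, pow_add, h a ha b hb, mul_one]
    have hck : (∑ a ∈ A, C (c a) * (X + C (a + b)) ^ D).coeff k
        = (∑ a ∈ A, c a * (a + b) ^ (n - 1 - k)) * (D.choose k : ZMod p) := by
      rw [← hs, finsetSum_coeff, Finset.sum_mul]
      refine Finset.sum_congr rfl fun a _ => ?_
      rw [coeff_C_mul, coeff_X_add_C_pow, mul_assoc]
    rw [hcomp, coeff_sub, hck, coeff_one]
    rcases Nat.eq_zero_or_pos k with rfl | hk0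
    · simp [hc1 b]
    · rw [hc0 b _ (by omega), if_neg (by omega)]; simp
  have hprod : (∏ b ∈ B, (X - C b) ^ n) ∣ F := by
    refine Finset.prod_dvd_of_coprime (fun x _ y _ hxy => ?_) hdvd
    exact (isCoprime_X_sub_C_of_isUnit_sub (sub_ne_zero.mpr hxy).isUnit).pow
  have h5 := natDegree_le_of_dvd hprod hF0
  rw [natDegree_prod_of_monic _ _ (fun b _ => (monic_X_sub_C b).pow n)] at h5
  simp only [natDegree_pow, natDegree_X_sub_C, mul_one, Finset.sum_const, smul_eq_mul] at h5
  rw [mul_comm]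
  omega

lemma card_Rp (p : ℕ) [Fact p.Prime] : p - 1 ≤ 2 * (Rp p).card := by
  have h := Finset.card_le_mul_card_image_of_maps_to (s := Finset.univ.erase (0 : ZMod p))
    (t := Rp p) (f := fun x => x * x) ?_ 2 ?_
  · rwa [Finset.card_erase_of_mem (Finset.mem_univ _), Finset.card_univ, ZMod.card] at h
  · intro a ha
    have : a ≠ 0 := Finset.ne_of_mem_erase ha
    simp [Rp, this]
  · intro b hb
    simp only [Rp, Finset.mem_filter] at hb
    obtain ⟨c, hc⟩ := hb.2.2
    refine (Finset.card_le_card (t := {c, -c}) ?_).trans Finset.card_le_two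
    intro x hx
    have hx := (Finset.mem_filter.mp hx).2
    rw [hc] at hx
    simpa using mul_self_eq_mul_self_iff.mp hx

lemma zmod_two_eq_one : ∀ x : ZMod 2, x ≠ 0 → x = 1 := by decide

theorem stmt_6 (p : ℕ) [Fact p.Prime] (A B : Finset (ZMod p))
    (hA : 2 ≤ A.card) (hB : 2 ≤ B.card) (h : A + B = Rp p)
    (η : ℝ) (hη0 : 0 ≤ η) (hη1 : η < 1 / 2)
    (hu : (uniqueRep A B : ℝ) ≤ η * ((p : ℝ) - 1)) :
    Real.sqrt p / (2 * (4 : ℝ) ^ η) ≤ A.card ∧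
      Real.sqrt p / (2 * (4 : ℝ) ^ η) ≤ B.card := by
  exfalso
  have hpp : p.Prime := Fact.out
  have hpow : ∀ a ∈ A, ∀ b ∈ B, (a + b) ^ (p / 2) = 1 := by
    intro a ha b hb
    have := Finset.add_mem_add ha hb
    rw [h] at this
    simp only [Rp, Finset.mem_filter] at this
    exact (ZMod.euler_criterion p this.2.1).mp this.2.2
  have hp2 : p ≠ 2 := by
    rintro rfl
    have h1 : A.card ≤ (A + B).card :=
      Finset.card_le_card_add_right (Finset.card_pos.mp (by omega))
    have h2 : Rp 2 ⊆ {1} := fun x hx =>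
      Finset.mem_singleton.mpr (zmod_two_eq_one x (Finset.mem_filter.mp hx).2.1)
    have h3 := Finset.card_le_card h2
    rw [h] at h1
    simp at h3
    omega
  have hodd := hpp.eq_two_or_odd.resolve_left hp2
  have h2p := hpp.two_le
  have hst := stepanov p A B (p / 2) (by omega) (by omega) (by omega) (by omega) hpow
  have hR := card_Rp p
  have himg : A + B = (A ×ˢ B).image (fun x => x.1 + x.2) := rfl
  have hinj : Set.InjOn (fun x : ZMod p × ZMod p => x.1 + x.2) (A ×ˢ B : Finset _) := by
    rw [← Finset.card_image_iff]
    apply le_antisymm Finset.card_image_le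
    rw [← himg, h, Finset.card_product]
    omega
  have huni : uniqueRep A B = (A + B).card := by
    unfold uniqueRep
    congr 1
    rw [Finset.filter_eq_self]
    intro x hx
    obtain ⟨a, ha, b, hb, rfl⟩ := Finset.mem_add.mp hx
    unfold repCount
    rw [Finset.card_eq_one]
    refine ⟨(a, b), ?_⟩
    ext ⟨a', b'⟩
    rw [Finset.mem_filter, Finset.mem_singleton]
    constructor
    · rintro ⟨h1, h2⟩
      exact hinj (Finset.mem_coe.mpr h1)
        (Finset.mem_coe.mpr (Finset.mk_mem_product ha hb)) h2
    · intro h1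
      rw [h1]
      exact ⟨Finset.mk_mem_product ha hb, rfl⟩
  rw [huni, h] at hu
  have h6 : (p : ℝ) ≤ 2 * ((Rp p).card : ℝ) + 1 := by exact_mod_cast (by omega)
  have h7 : (2 : ℝ) ≤ p := by exact_mod_cast h2p
  nlinarith
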